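/- arXiv:1704.00425 — 6 statements merged into one kernel-verified Lean document; each statement's English description precedes it below -/
import Mathlib

section
/- There exists a universal constant δ₀ > 0 such that for every integer n ≥ 1, every ν > 0, every k ∈ ℤⁿ with k ≠ 0, and every t > 0, one has 0 < S(t,k) ≤ exp( −δ₀ min( ν |k|² t³ , ν^{−1} |k|² t ) ). -/
open Real MeasureTheory

/-- Euclidean norm of an integer vector `k ∈ ℤⁿ`. -/
noncomputable def knorm {n : ℕ} (k : Fin n → ℤ) : ℝ :=
  Real.sqrt (∑ i, ((k i : ℝ)) ^ 2)

/-- The kernel `S(t,k) = exp[ -ν⁻¹|k|² ( t + 2(e^{-νt}-1)/ν - (e^{-2νt}-1)/(2ν) ) ]`. -/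
noncomputable def Sker {n : ℕ} (ν t : ℝ) (k : Fin n → ℤ) : ℝ :=
  Real.exp (-(ν⁻¹) * (knorm k) ^ 2 *
    (t + 2 * (Real.exp (-(ν * t)) - 1) / ν - (Real.exp (-(2 * ν * t)) - 1) / (2 * ν)))

/-- The profile function, whose derivative is `(1 - e⁻ˢ)²`, dominates `s³ / (3 (1 + s)²)`. -/
lemma cube_div_le_exp_profile {s : ℝ} (hs : 0 ≤ s) :
    s ^ 3 / (3 * (1 + s) ^ 2) ≤ s + 2 * (exp (-s) - 1) - (exp (-(2 * s)) - 1) / 2 := by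
  have hderiv : ∀ x : ℝ, 0 ≤ x → HasDerivAt
      (fun y : ℝ => y + 2 * (exp (-y) - 1) - (exp (-(2 * y)) - 1) / 2 - y ^ 3 / (3 * (1 + y) ^ 2))
      ((1 - exp (-x)) ^ 2 - x ^ 2 * (3 + x) / (3 * (1 + x) ^ 3)) x := by
    intro x hx
    have hx1 : 1 + x ≠ 0 := by positivity
    have h1 : HasDerivAt (fun y : ℝ => exp (-y)) (exp (-x) * -1) x := (hasDerivAt_neg x).exp
    have h2 : HasDerivAt (fun y : ℝ => exp (-(2 * y))) (exp (-(2 * x)) * -(2 * 1)) x :=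
      ((hasDerivAt_id x).const_mul 2).neg.exp
    have h3 : HasDerivAt (fun y : ℝ => 3 * (1 + y) ^ 2) (3 * (2 * (1 + x))) x := by
      simpa using (((hasDerivAt_id x).const_add 1).pow 2).const_mul 3
    have h4 : HasDerivAt (fun y : ℝ => y ^ 3) (3 * x ^ 2) x := by
      simpa using hasDerivAt_pow 3 x
    refine ((((hasDerivAt_id x).add ((h1.sub_const 1).const_mul 2)).sub
      ((h2.sub_const 1).div_const 2)).sub (h4.div h3 (by positivity))).congr_deriv ?_
    have he : exp (-(2 * x)) = exp (-x) ^ 2 := by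
      rw [← exp_nat_mul]
      push_cast
      ring_nf
    rw [he]
    field_simp
    ring
  have hmono := monotoneOn_of_deriv_nonneg (convex_Ici (0 : ℝ))
    (fun x hx => (hderiv x hx).continuousAt.continuousWithinAt)
    (fun x hx => (hderiv x (interior_subset hx)).differentiableAt.differentiableWithinAt)
    (fun x hx => by
      have hx : 0 ≤ x := interior_subset hx
      rw [(hderiv x hx).deriv, sub_nonneg]
      have hexp : exp (-x) ≤ 1 / (1 + x) := by
        rw [exp_neg, ← one_div]
        exact one_div_le_one_div_of_le (by positivity) (by linarith [add_one_le_exp x])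
      have hle : x / (1 + x) ≤ 1 - exp (-x) := by
        have : x / (1 + x) = 1 - 1 / (1 + x) := by
          field_simp
          ring
        linarith
      calc x ^ 2 * (3 + x) / (3 * (1 + x) ^ 3)
          ≤ x ^ 2 * (3 * (1 + x)) / (3 * (1 + x) ^ 3) := by
            gcongr
            linarith
        _ = (x / (1 + x)) ^ 2 := by field_simp
        _ ≤ (1 - exp (-x)) ^ 2 := by gcongr)
  have h := hmono Set.self_mem_Ici hs hs
  norm_num at h
  linarith

lemma min_cube_self_le_exp_profile {s : ℝ} (hs : 0 ≤ s) :
    1 / 12 * min (s ^ 3) s ≤ s + 2 * (exp (-s) - 1) - (exp (-(2 * s)) - 1) / 2 := by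
  refine le_trans ?_ (cube_div_le_exp_profile hs)
  rw [le_div_iff₀ (by positivity)]
  rcases le_total s 1 with h | h
  · have hsq : (1 + s) ^ 2 ≤ 4 := by nlinarith
    calc 1 / 12 * min (s ^ 3) s * (3 * (1 + s) ^ 2)
        ≤ 1 / 12 * s ^ 3 * (3 * 4) := by
          gcongr
          exact min_le_left _ _
      _ = s ^ 3 := by ring
  · have hsq : (1 + s) ^ 2 ≤ 4 * s ^ 2 := by nlinarith
    calc 1 / 12 * min (s ^ 3) s * (3 * (1 + s) ^ 2)
        ≤ 1 / 12 * s * (3 * (4 * s ^ 2)) := by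
          gcongr
          exact min_le_right _ _
      _ = s ^ 3 := by ring

/-- universal decay estimate
`0 < S(t,k) ≤ exp(-δ₀ min(ν|k|²t³, ν⁻¹|k|²t))`. -/
theorem stmt2 :
    ∃ δ₀ : ℝ, 0 < δ₀ ∧
      ∀ (n : ℕ), 1 ≤ n → ∀ ν : ℝ, 0 < ν → ∀ k : Fin n → ℤ, k ≠ 0 → ∀ t : ℝ, 0 < t →
        0 < Sker ν t k ∧
        Sker ν t k ≤ Real.exp (-(δ₀ * min (ν * (knorm k) ^ 2 * t ^ 3)
          (ν⁻¹ * (knorm k) ^ 2 * t))) := by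
  refine ⟨1 / 12, by norm_num, fun n _ ν hν k _ t ht => ⟨exp_pos _, exp_le_exp.mpr ?_⟩⟩
  have hprofile := mul_le_mul_of_nonneg_left (min_cube_self_le_exp_profile (mul_pos hν ht).le)
    (by positivity : 0 ≤ (knorm k) ^ 2 / ν ^ 2)
  have hmin : min (ν * (knorm k) ^ 2 * t ^ 3) (ν⁻¹ * (knorm k) ^ 2 * t) =
      (knorm k) ^ 2 / ν ^ 2 * min ((ν * t) ^ 3) (ν * t) := by
    rw [mul_min_of_nonneg _ _ (by positivity)]
    congr 1 <;> field_simp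
  have hexponent : -(ν⁻¹) * (knorm k) ^ 2 *
      (t + 2 * (exp (-(ν * t)) - 1) / ν - (exp (-(2 * ν * t)) - 1) / (2 * ν)) =
      -((knorm k) ^ 2 / ν ^ 2 *
        (ν * t + 2 * (exp (-(ν * t)) - 1) - (exp (-(2 * (ν * t))) - 1) / 2)) := by
    rw [mul_assoc 2 ν t]
    field_simp
  rw [hmin, hexponent]
  linarith
end

section
/- For every p ∈ (0, 1] there exists δ̄ = δ̄(p) > 0 such that for every δ ∈ (0, δ̄] there exist constants C = C(p, δ) > 0 and ν₀ = ν₀(p, δ) > 0 with the following property: for every integer n ≥ 1, every ν ∈ (0, ν₀], every k ∈ ℤⁿ with k ≠ 0, and all real numbers 0 ≤ τ ≤ t, one has e^{δ ν^{1/3} t} S(t−τ, k)^p ≤ C e^{δ ν^{1/3} τ}. -/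
open Real MeasureTheory

/-- The profile `x + 2(e^{-x} - 1) - (e^{-2x} - 1)/2`, the primitive of `(1 - e^{-x})²`
vanishing at `0`. -/
noncomputable def kerProfile (x : ℝ) : ℝ :=
  x + 2 * (Real.exp (-x) - 1) - (Real.exp (-(2 * x)) - 1) / 2

theorem hasDerivAt_kerProfile (x : ℝ) :
    HasDerivAt kerProfile ((1 - Real.exp (-x)) ^ 2) x := by
  have h1 : HasDerivAt (fun y : ℝ => Real.exp (-y)) (Real.exp (-x) * (-1)) x :=
    (hasDerivAt_id x).neg.exp
  have h2 : HasDerivAt (fun y : ℝ => Real.exp (-(2 * y))) (Real.exp (-(2 * x)) * (-(2 * 1))) x :=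
    ((hasDerivAt_id x).const_mul 2).neg.exp
  have h := ((hasDerivAt_id x).add ((h1.sub_const 1).const_mul 2)).sub
    ((h2.sub_const 1).div_const 2)
  refine h.congr_deriv ?_
  have he : Real.exp (-(2 * x)) = Real.exp (-x) ^ 2 := by
    rw [← Real.exp_nat_mul]; congr 1; push_cast; ring
  rw [he]; ring

theorem div_one_add_le_one_sub_exp_neg {x : ℝ} (hx : 0 ≤ x) :
    x / (1 + x) ≤ 1 - Real.exp (-x) := by
  have h1 : Real.exp (-x) ≤ (1 + x)⁻¹ := by
    rw [Real.exp_neg]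
    exact inv_anti₀ (by linarith) (by linarith [Real.add_one_le_exp x])
  have h2 : x / (1 + x) = 1 - (1 + x)⁻¹ := by field_simp; ring
  linarith

theorem cube_le_kerProfile {x : ℝ} (h0 : 0 ≤ x) (h1 : x ≤ 1) : x ^ 3 / 12 ≤ kerProfile x := by
  have hd : ∀ y : ℝ, HasDerivAt (fun z => kerProfile z - z ^ 3 / 12)
      ((1 - Real.exp (-y)) ^ 2 - 3 * y ^ 2 / 12) y := fun y =>
    ((hasDerivAt_kerProfile y).sub ((hasDerivAt_pow 3 y).div_const 12)).congr_deriv (by norm_num)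
  have hmono : MonotoneOn (fun z => kerProfile z - z ^ 3 / 12) (Set.Icc 0 1) := by
    refine monotoneOn_of_hasDerivWithinAt_nonneg (convex_Icc 0 1)
      (fun y _ => (hd y).continuousAt.continuousWithinAt)
      (fun y _ => (hd y).hasDerivWithinAt) fun y hy => ?_
    rw [interior_Icc] at hy
    have hle : y / 2 ≤ 1 - Real.exp (-y) :=
      (div_le_div_of_nonneg_left hy.1.le (by linarith [hy.1]) (by linarith [hy.2])).trans
        (div_one_add_le_one_sub_exp_neg hy.1.le)
    nlinarith [hy.1]
  have h := hmono (Set.left_mem_Icc.2 zero_le_one) ⟨h0, h1⟩ h0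
  simp [kerProfile] at h ⊢
  linarith

theorem linear_le_kerProfile {x : ℝ} (h1 : 1 ≤ x) : x / 12 ≤ kerProfile x := by
  have hd : ∀ y : ℝ, HasDerivAt (fun z => kerProfile z - z / 12)
      ((1 - Real.exp (-y)) ^ 2 - 1 / 12) y := fun y =>
    (hasDerivAt_kerProfile y).sub ((hasDerivAt_id y).div_const 12)
  have hmono : MonotoneOn (fun z => kerProfile z - z / 12) (Set.Ici 1) := by
    refine monotoneOn_of_hasDerivWithinAt_nonneg (convex_Ici 1)
      (fun y _ => (hd y).continuousAt.continuousWithinAt)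
      (fun y _ => (hd y).hasDerivWithinAt) fun y hy => ?_
    rw [interior_Ici] at hy
    have hy' : 1 < y := hy
    have hle : 1 / 2 ≤ 1 - Real.exp (-y) := by
      refine le_trans ?_ (div_one_add_le_one_sub_exp_neg (by linarith : (0 : ℝ) ≤ y))
      rw [div_le_div_iff₀ (by norm_num) (by linarith)]
      linarith
    nlinarith
  have h := hmono Set.self_mem_Ici h1 h1
  have h' := cube_le_kerProfile zero_le_one le_rfl
  simp only at h
  linarith

theorem sub_one_le_kerProfile_div {r s : ℝ} (hr : 0 < r) (hr1 : r ≤ 1) (hs : 0 ≤ s) :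
    (r * s - 1) / 12 ≤ kerProfile (r ^ 3 * s) / (r ^ 3) ^ 2 := by
  rw [le_div_iff₀ (by positivity)]
  rcases le_total (r ^ 3 * s) 1 with h | h
  · refine le_trans ?_ (cube_le_kerProfile (by positivity) h)
    have hy : r * s - 1 ≤ (r * s) ^ 3 := by
      have : 0 ≤ r * s := by positivity
      nlinarith [sq_nonneg (r * s - 1), mul_nonneg this (sq_nonneg (r * s - 1))]
    have := mul_le_mul_of_nonneg_right hy (by positivity : 0 ≤ (r ^ 3) ^ 2)
    linarith [show (r * s) ^ 3 * (r ^ 3) ^ 2 = (r ^ 3 * s) ^ 3 by ring]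
  · refine le_trans ?_ (linear_le_kerProfile h)
    have h4 : r ^ 4 ≤ 1 := pow_le_one₀ hr.le hr1
    have := mul_le_mul_of_nonneg_right h4 (by positivity : 0 ≤ r ^ 3 * s)
    have h6 : 0 ≤ (r ^ 3) ^ 2 := by positivity
    linarith [show (r * s - 1) * (r ^ 3) ^ 2 = r ^ 4 * (r ^ 3 * s) - (r ^ 3) ^ 2 by ring]

theorem kerProfile_nonneg {x : ℝ} (hx : 0 ≤ x) : 0 ≤ kerProfile x := by
  rcases le_total x 1 with h | h
  · exact le_trans (by positivity) (cube_le_kerProfile hx h)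
  · exact le_trans (by positivity) (linear_le_kerProfile h)

theorem one_le_knorm_sq {n : ℕ} {k : Fin n → ℤ} (hk : k ≠ 0) : 1 ≤ knorm k ^ 2 := by
  obtain ⟨i, hi⟩ := Function.ne_iff.1 hk
  rw [knorm, Real.sq_sqrt (Finset.sum_nonneg fun _ _ => sq_nonneg _)]
  have h1 : (1 : ℝ) ≤ (k i : ℝ) ^ 2 := by
    exact_mod_cast Int.add_one_le_iff.2 (sq_pos_of_ne_zero hi)
  exact h1.trans (Finset.single_le_sum (f := fun i => (k i : ℝ) ^ 2)
    (fun _ _ => sq_nonneg _) (Finset.mem_univ i))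

theorem Sker_eq {n : ℕ} {ν : ℝ} (hν : 0 < ν) (s : ℝ) (k : Fin n → ℤ) :
    Sker ν s k = Real.exp (-(knorm k ^ 2 * (kerProfile (ν * s) / ν ^ 2))) := by
  rw [Sker, kerProfile]
  congr 1
  rw [← mul_assoc 2 ν s]
  field_simp

/-- `e^{δν^{1/3}t} S(t-τ,k)^p ≲ e^{δν^{1/3}τ}` for `δ` small. -/
theorem stmt3 (p : ℝ) (hp : p ∈ Set.Ioc (0 : ℝ) 1) :
    ∃ δbar : ℝ, 0 < δbar ∧
      ∀ δ ∈ Set.Ioc (0 : ℝ) δbar,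
        ∃ C : ℝ, 0 < C ∧ ∃ ν₀ : ℝ, 0 < ν₀ ∧
          ∀ (n : ℕ), 1 ≤ n → ∀ ν ∈ Set.Ioc (0 : ℝ) ν₀, ∀ k : Fin n → ℤ, k ≠ 0 →
            ∀ τ t : ℝ, 0 ≤ τ → τ ≤ t →
              Real.exp (δ * ν ^ ((1 : ℝ) / 3) * t) * (Sker ν (t - τ) k) ^ p
                ≤ C * Real.exp (δ * ν ^ ((1 : ℝ) / 3) * τ) := by
  have hp0 : 0 < p := hp.1
  refine ⟨p / 12, by positivity, fun δ hδ => ⟨Real.exp δ, Real.exp_pos _, 1, one_pos, ?_⟩⟩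
  intro n _ ν hν k hk τ t _ hτt
  have hν0 : 0 < ν := hν.1
  have hr : 0 < ν ^ ((1 : ℝ) / 3) := Real.rpow_pos_of_pos hν0 _
  have hr1 : ν ^ ((1 : ℝ) / 3) ≤ 1 := Real.rpow_le_one hν0.le hν.2 (by norm_num)
  have hr3 : (ν ^ ((1 : ℝ) / 3)) ^ 3 = ν := by
    rw [← Real.rpow_natCast, ← Real.rpow_mul hν0.le]; norm_num
  rw [Sker_eq hν0, ← Real.exp_mul, ← Real.exp_add, ← Real.exp_add, Real.exp_le_exp]
  generalize ν ^ ((1 : ℝ) / 3) = r at *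
  have hs : 0 ≤ t - τ := sub_nonneg.2 hτt
  have hmain := sub_one_le_kerProfile_div hr hr1 hs
  rw [hr3] at hmain
  have hQ0 : 0 ≤ kerProfile (ν * (t - τ)) / ν ^ 2 :=
    div_nonneg (kerProfile_nonneg (by positivity)) (by positivity)
  generalize kerProfile (ν * (t - τ)) / ν ^ 2 = Q at *
  have hkQ : Q ≤ knorm k ^ 2 * Q := le_mul_of_one_le_left hQ0 (one_le_knorm_sq hk)
  have hpQ : p * Q ≤ p * (knorm k ^ 2 * Q) := mul_le_mul_of_nonneg_left hkQ hp0.le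
  have hδQ : δ * (12 * Q) ≤ p / 12 * (12 * Q) :=
    mul_le_mul_of_nonneg_right hδ.2 (by positivity)
  have hδy : δ * (r * (t - τ) - 1) ≤ δ * (12 * Q) :=
    mul_le_mul_of_nonneg_left (by linarith) hδ.1.le
  linarith
end

section
/- There exist universal constants C > 0 and ν₀ > 0 such that for every integer n ≥ 1, every ν ∈ (0, ν₀], every k ∈ ℤⁿ with |k| ≥ 1, and every s ≥ 0, one has S(s,k)^{1/4} e^{ν s} ≤ C. -/
open Real MeasureTheory

/-- The primitive of `(1 - e^{-x})²` vanishing at `0` is nonnegative on `[0, ∞)`. -/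
theorem add_two_mul_exp_neg_sub_nonneg {x : ℝ} (hx : 0 ≤ x) :
    0 ≤ x + 2 * (Real.exp (-x) - 1) - (Real.exp (-(2 * x)) - 1) / 2 := by
  have hd (y : ℝ) : HasDerivAt
      (fun y : ℝ => y + 2 * (Real.exp (-y) - 1) - (Real.exp (-(2 * y)) - 1) / 2)
      ((1 - Real.exp (-y)) ^ 2) y := by
    have h1 := (((hasDerivAt_neg y).exp.sub_const 1).const_mul 2)
    have h2 := ((((hasDerivAt_id y).const_mul 2).neg.exp.sub_const 1).div_const 2)
    refine (((hasDerivAt_id y).add h1).sub h2).congr_deriv ?_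
    have h3 : Real.exp (-(2 * y)) = Real.exp (-y) ^ 2 := by
      rw [← Real.exp_nat_mul]; congr 1; push_cast; ring
    simp only [id, Pi.neg_apply, h3]
    ring
  have hm := monotone_of_deriv_nonneg (fun y => (hd y).differentiableAt)
    (fun y => by rw [(hd y).deriv]; positivity)
  simpa using hm hx

/-- `S(s,k)^{1/4} e^{νs} ≤ C` for `|k| ≥ 1` and `ν` small. -/
theorem stmt4 :
    ∃ C : ℝ, 0 < C ∧ ∃ ν₀ : ℝ, 0 < ν₀ ∧
      ∀ (n : ℕ), 1 ≤ n → ∀ ν ∈ Set.Ioc (0 : ℝ) ν₀, ∀ k : Fin n → ℤ, 1 ≤ knorm k →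
        ∀ s : ℝ, 0 ≤ s →
          (Sker ν s k) ^ ((1 : ℝ) / 4) * Real.exp (ν * s) ≤ C := by
  refine ⟨Real.exp (3 / 2), Real.exp_pos _, 1 / 2, by norm_num, ?_⟩
  rintro n - ν ⟨hν, hν'⟩ k hk s hs
  rw [Sker, ← Real.exp_mul, ← Real.exp_add, Real.exp_le_exp]
  have hx : 0 ≤ ν * s := by positivity
  have hB := add_two_mul_exp_neg_sub_nonneg hx
  have hy1 : Real.exp (-(ν * s)) ≤ 1 := Real.exp_le_one_iff.mpr (by linarith)
  have hy0 := Real.exp_pos (-(ν * s))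
  have hsq : Real.exp (-(2 * (ν * s))) = Real.exp (-(ν * s)) ^ 2 := by
    rw [← Real.exp_nat_mul]; congr 1; push_cast; ring
  have hBx : ν * s - 3 / 2 ≤
      ν * s + 2 * (Real.exp (-(ν * s)) - 1) - (Real.exp (-(2 * (ν * s))) - 1) / 2 := by
    rw [hsq]; nlinarith
  have hc : 1 ≤ (ν⁻¹ * knorm k / 2) ^ 2 := by
    have h2 : 2 ≤ ν⁻¹ := by
      rw [le_inv_comm₀ (by norm_num) hν]; linarith
    have : 1 ≤ ν⁻¹ * knorm k / 2 := by nlinarith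
    exact one_le_pow₀ this
  have hcB := le_mul_of_one_le_left hB hc
  have hid : -(ν⁻¹) * knorm k ^ 2 *
      (s + 2 * (Real.exp (-(ν * s)) - 1) / ν - (Real.exp (-(2 * ν * s)) - 1) / (2 * ν)) * (1 / 4)
      = -((ν⁻¹ * knorm k / 2) ^ 2 *
        (ν * s + 2 * (Real.exp (-(ν * s)) - 1) - (Real.exp (-(2 * (ν * s))) - 1) / 2)) := by
    rw [mul_assoc 2 ν s]
    field_simp
    ring
  rw [hid]
  linarith
end

section
/- For every p ∈ (0, 1] there exists a constant C = C(p) > 0 such that for every integer n ≥ 1, every ν ∈ (0, 1], every k ∈ ℤⁿ with k ≠ 0, and all real numbers 0 ≤ τ' ≤ t, one has S(t−τ', k)^p · (|k| / (2ν²)) · (e^{−ν(t−τ')} − 1)² ≤ C ν^{−2/3}. -/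
open Real MeasureTheory

/-- The third partial sum of the power series of `-log (1 - y)` is a lower bound for it. -/
theorem cubic_le_neg_log_one_sub {y : ℝ} (hy0 : 0 ≤ y) (hy1 : y < 1) :
    y + y ^ 2 / 2 + y ^ 3 / 3 ≤ -Real.log (1 - y) := by
  have h := Real.hasSum_pow_div_log_of_abs_lt_one (x := y) (abs_lt.2 ⟨by linarith, hy1⟩)
  have h3 := sum_le_hasSum (Finset.range 3) (fun i _ => by positivity) h
  norm_num [Finset.sum_range_succ] at h3
  linarith

/-- The exponent of the kernel is at least cubic in `1 - exp (-s)`. -/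
theorem cube_one_sub_exp_neg_le {s : ℝ} (hs : 0 ≤ s) :
    (1 - Real.exp (-s)) ^ 3 / 3 ≤
      s + 2 * (Real.exp (-s) - 1) - (Real.exp (-(2 * s)) - 1) / 2 := by
  have h1 : Real.exp (-s) ≤ 1 := Real.exp_le_one_iff.2 (by linarith)
  have h2 := Real.exp_pos (-s)
  have h := cubic_le_neg_log_one_sub (y := 1 - Real.exp (-s)) (by linarith) (by linarith)
  have h4 : Real.exp (-(2 * s)) = Real.exp (-s) ^ 2 := by
    rw [← Real.exp_nat_mul]; congr 1; push_cast; ring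
  rw [sub_sub_cancel, Real.log_exp, neg_neg] at h
  rw [h4]
  linarith

/-- A nonzero integer vector has Euclidean norm at least one. -/
theorem one_le_knorm {n : ℕ} {k : Fin n → ℤ} (hk : k ≠ 0) : 1 ≤ knorm k := by
  obtain ⟨i, hi⟩ := Function.ne_iff.1 hk
  have h1 : (1 : ℝ) ≤ (k i : ℝ) ^ 2 := by
    rw [one_le_sq_iff_one_le_abs]
    exact_mod_cast Int.one_le_abs hi
  exact Real.one_le_sqrt.2 (h1.trans
    (Finset.single_le_sum (f := fun i => (k i : ℝ) ^ 2) (fun j _ => sq_nonneg _)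
      (Finset.mem_univ i)))

/-- The kernel is bounded by the exponential of a negative cubic in `1 - exp (-ν t)`. -/
theorem Sker_le {n : ℕ} {ν t : ℝ} (hν : 0 < ν) (ht : 0 ≤ t) (k : Fin n → ℤ) :
    Sker ν t k ≤
      Real.exp (-(knorm k ^ 2 * (1 - Real.exp (-(ν * t))) ^ 3 / ν ^ 2 / 3)) := by
  have h := cube_one_sub_exp_neg_le (mul_nonneg hν.le ht)
  have h2 := mul_le_mul_of_nonneg_left h (by positivity : 0 ≤ knorm k ^ 2 / ν ^ 2)
  rw [← mul_assoc] at h2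
  unfold Sker
  rw [Real.exp_le_exp]
  have e : -(ν⁻¹) * (knorm k) ^ 2 *
      (t + 2 * (Real.exp (-(ν * t)) - 1) / ν - (Real.exp (-(2 * ν * t)) - 1) / (2 * ν)) =
      -(knorm k ^ 2 / ν ^ 2 * (ν * t + 2 * (Real.exp (-(ν * t)) - 1)
        - (Real.exp (-(2 * ν * t)) - 1) / 2)) := by
    field_simp
  rw [e, neg_le_neg_iff]
  exact le_of_eq_of_le (by ring) h2

/-- Interpolation between `1` and `K ^ 2 * y ^ 3 / m ^ 6`. -/
theorem mul_sq_div_pow_six_le {K y m : ℝ} (hK : 1 ≤ K) (hm : 0 < m) :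
    K * y ^ 2 / m ^ 6 ≤ (1 + |K ^ 2 * y ^ 3 / m ^ 6|) / m ^ 2 := by
  set a := |K ^ 2 * y ^ 3 / m ^ 6| with ha
  have ha0 : 0 ≤ a := abs_nonneg _
  have hw : K * y ^ 2 / m ^ 4 ≤ 1 + a := by
    refine le_of_pow_le_pow_left₀ three_ne_zero (by positivity) ?_
    calc (K * y ^ 2 / m ^ 4) ^ 3 = K ^ 3 * (y ^ 6 / m ^ 12) := by field_simp
      _ ≤ K ^ 4 * (y ^ 6 / m ^ 12) := by gcongr; norm_num
      _ = a ^ 2 := by rw [ha, sq_abs]; field_simp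
      _ ≤ (1 + a) ^ 3 := by nlinarith [pow_nonneg ha0 3, pow_nonneg ha0 2]
  calc K * y ^ 2 / m ^ 6 = K * y ^ 2 / m ^ 4 / m ^ 2 := by field_simp
    _ ≤ _ := by gcongr

/-- An affine function times a decaying exponential is bounded. -/
theorem exp_neg_mul_mul_one_add_le {c a : ℝ} (hc : 0 < c) (ha : 0 ≤ a) :
    Real.exp (-(c * a)) * (1 + a) ≤ 1 + 1 / c := by
  have h1 := Real.add_one_le_exp (c * a)
  have h2 : 1 + a ≤ (1 + 1 / c) * Real.exp (c * a) := by
    calc 1 + a ≤ (1 + 1 / c) * (c * a + 1) := by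
          have : (1 + 1 / c) * (c * a + 1) = 1 + a + (c * a + 1 / c) := by field_simp; ring
          rw [this]
          have : 0 ≤ c * a + 1 / c := by positivity
          linarith
      _ ≤ _ := by gcongr
  rw [Real.exp_neg, inv_mul_le_iff₀ (Real.exp_pos _), mul_comm]
  exact h2

/-- `S(t-τ',k)^p (|k|/(2ν²)) (e^{-ν(t-τ')}-1)² ≤ C ν^{-2/3}`. -/
theorem stmt5 (p : ℝ) (hp : p ∈ Set.Ioc (0 : ℝ) 1) :
    ∃ C : ℝ, 0 < C ∧
      ∀ (n : ℕ), 1 ≤ n → ∀ ν ∈ Set.Ioc (0 : ℝ) 1, ∀ k : Fin n → ℤ, k ≠ 0 →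
        ∀ τ' t : ℝ, 0 ≤ τ' → τ' ≤ t →
          (Sker ν (t - τ') k) ^ p * (knorm k / (2 * ν ^ 2)) *
              (Real.exp (-(ν * (t - τ'))) - 1) ^ 2
            ≤ C * ν ^ (-(2 : ℝ) / 3) := by
  obtain ⟨hp0, -⟩ := hp
  refine ⟨(1 + 1 / (p / 3)) / 2, by positivity, ?_⟩
  rintro n - ν ⟨hν, -⟩ k hk τ' t - hτ
  have hs : 0 ≤ t - τ' := sub_nonneg.2 hτ
  have hK := one_le_knorm hk
  have hS := Sker_le hν hs k
  have hy : 0 ≤ 1 - Real.exp (-(ν * (t - τ'))) :=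
    sub_nonneg.2 (Real.exp_le_one_iff.2 (neg_nonpos.2 (mul_nonneg hν.le hs)))
  rw [← neg_sub 1 (Real.exp (-(ν * (t - τ')))), neg_sq]
  generalize 1 - Real.exp (-(ν * (t - τ'))) = y at hS hy ⊢
  generalize knorm k = K at hK hS ⊢
  have hK0 : 0 ≤ K := zero_le_one.trans hK
  obtain ⟨m, hm, rfl⟩ : ∃ m : ℝ, 0 < m ∧ m ^ 3 = ν :=
    ⟨ν ^ (1 / 3 : ℝ), by positivity, by rw [← Real.rpow_mul_natCast hν.le]; norm_num⟩
  have hm2 : (m ^ 3) ^ (-(2 : ℝ) / 3) = (m ^ 2)⁻¹ := by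
    rw [← Real.rpow_natCast m 3, ← Real.rpow_mul hm.le, ← Real.rpow_natCast m 2,
      ← Real.rpow_neg hm.le]
    norm_num
  have hI := mul_sq_div_pow_six_le (y := y) hK hm
  rw [abs_of_nonneg (by positivity)] at hI
  have hSp : Sker (m ^ 3) (t - τ') k ^ p ≤ Real.exp (-(p / 3 * (K ^ 2 * y ^ 3 / m ^ 6))) := by
    refine (Real.rpow_le_rpow (Real.exp_pos _).le hS hp0.le).trans_eq ?_
    rw [← Real.exp_mul]
    congr 1
    ring
  rw [hm2]
  calc Sker (m ^ 3) (t - τ') k ^ p * (K / (2 * (m ^ 3) ^ 2)) * y ^ 2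
      = Sker (m ^ 3) (t - τ') k ^ p * (K * y ^ 2 / m ^ 6) / 2 := by ring
    _ ≤ Real.exp (-(p / 3 * (K ^ 2 * y ^ 3 / m ^ 6))) *
          ((1 + K ^ 2 * y ^ 3 / m ^ 6) / m ^ 2) / 2 := by gcongr
    _ = Real.exp (-(p / 3 * (K ^ 2 * y ^ 3 / m ^ 6))) *
          (1 + K ^ 2 * y ^ 3 / m ^ 6) / 2 * (m ^ 2)⁻¹ := by ring
    _ ≤ _ := by
      gcongr
      exact exp_neg_mul_mul_one_add_le (by positivity) (by positivity)
end

section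
/- There exists a universal constant C > 0 such that for every integer n ≥ 1, every ν > 0, all real numbers 0 ≤ τ ≤ t, and all vectors k, ℓ ∈ ℝⁿ, one has |k| t ≤ C ( ⟨ντ⟩ + ⟨ν(t−τ)⟩ ) ( |ℓ| (1 − e^{−ντ})/ν + | k (1 − e^{−νt})/ν − ℓ (1 − e^{−ντ})/ν | ). -/
open Real MeasureTheory

/-- The Japanese bracket `⟨x⟩ = (1+x²)^{1/2}` of a real number. -/
noncomputable def jap (x : ℝ) : ℝ := Real.sqrt (1 + x ^ 2)

theorem one_le_jap (x : ℝ) : 1 ≤ jap x :=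
  Real.one_le_sqrt.mpr (by nlinarith [sq_nonneg x])

theorem le_jap (x : ℝ) : x ≤ jap x :=
  Real.le_sqrt_of_sq_le (by linarith)

theorem le_one_add_mul_one_sub_exp_neg (s : ℝ) :
    s ≤ (1 + s) * (1 - Real.exp (-s)) := by
  have h : (1 + s) * Real.exp (-s) ≤ Real.exp s * Real.exp (-s) := by
    gcongr
    linarith [Real.add_one_le_exp s]
  rw [← Real.exp_add, add_neg_cancel, Real.exp_zero] at h
  linarith

/-- `|k|t ≤ C (⟨ντ⟩+⟨ν(t-τ)⟩)(|ℓ|(1-e^{-ντ})/ν + |k(1-e^{-νt})/ν - ℓ(1-e^{-ντ})/ν|)`. -/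
theorem stmt9 :
    ∃ C : ℝ, 0 < C ∧
      ∀ (n : ℕ), 1 ≤ n → ∀ ν : ℝ, 0 < ν → ∀ τ t : ℝ, 0 ≤ τ → τ ≤ t →
        ∀ k ℓ : EuclideanSpace ℝ (Fin n),
          ‖k‖ * t ≤ C * (jap (ν * τ) + jap (ν * (t - τ))) *
            (‖ℓ‖ * ((1 - Real.exp (-(ν * τ))) / ν) +
              ‖((1 - Real.exp (-(ν * t))) / ν) • k
                - ((1 - Real.exp (-(ν * τ))) / ν) • ℓ‖) := by
  refine ⟨2, two_pos, fun n _ ν hν τ t hτ ht k ℓ => ?_⟩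
  set A := (1 - Real.exp (-(ν * t))) / ν with hA
  set B := (1 - Real.exp (-(ν * τ))) / ν with hB
  set J := jap (ν * τ) + jap (ν * (t - τ)) with hJ
  have hs : 0 ≤ ν * t := mul_nonneg hν.le (hτ.trans ht)
  have hA0 : 0 ≤ A :=
    div_nonneg (sub_nonneg.mpr (Real.exp_le_one_iff.mpr (by linarith))) hν.le
  have hB0 : 0 ≤ B :=
    div_nonneg (sub_nonneg.mpr (Real.exp_le_one_iff.mpr (by nlinarith))) hν.le
  have hJs : 1 + ν * t ≤ 2 * J := by
    linarith [one_le_jap (ν * τ), one_le_jap (ν * (t - τ)), le_jap (ν * τ),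
      le_jap (ν * (t - τ)), mul_sub ν t τ]
  have htA : t ≤ (1 + ν * t) * A := by
    rw [hA, ← mul_div_assoc, le_div_iff₀ hν, mul_comm t]
    exact le_one_add_mul_one_sub_exp_neg (ν * t)
  have hk : ‖k‖ * A ≤ ‖ℓ‖ * B + ‖A • k - B • ℓ‖ := by
    have h := norm_le_norm_add_norm_sub' (A • k) (B • ℓ)
    rw [norm_smul, norm_smul, Real.norm_of_nonneg hA0, Real.norm_of_nonneg hB0] at h
    linarith
  calc ‖k‖ * t ≤ ‖k‖ * (2 * J * A) := by
        gcongr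
        exact htA.trans (by gcongr)
    _ = 2 * J * (‖k‖ * A) := by ring
    _ ≤ 2 * J * (‖ℓ‖ * B + ‖A • k - B • ℓ‖) := by
        gcongr
        linarith
end

section
/- There exists a universal constant C > 0 such that for every integer n ≥ 1, every ν > 0, every k ∈ ℤⁿ with k ≠ 0, and every s > 0, one has S(s,k)^{1/3} · |k|² ( (1 − e^{−νs})/ν )² ≤ C (ν s)^{−1/4} |k|^{3/2} ( (1 − e^{−νs})/ν )^{3/2}. -/
open Real MeasureTheory

/-- The integral of `(1 - e^{-u})²` over `[0, x]` is at least `x (1 - e^{-x})² / 3`. -/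
lemma mul_one_sub_exp_neg_sq_le {x : ℝ} (hx : 0 ≤ x) :
    x * (1 - exp (-x)) ^ 2 ≤
      3 * (x + 2 * (exp (-x) - 1) - (exp (-(2 * x)) - 1) / 2) := by
  have hmono : MonotoneOn (fun u : ℝ => 3 * (u + 2 * (exp (-u) - 1) - (exp (-u) ^ 2 - 1) / 2)
      - u * (1 - exp (-u)) ^ 2) (Set.Ici 0) := by
    have hd (u : ℝ) : HasDerivAt (fun u : ℝ => 3 * (u + 2 * (exp (-u) - 1)
        - (exp (-u) ^ 2 - 1) / 2) - u * (1 - exp (-u)) ^ 2)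
        (2 * (1 - exp (-u)) * ((1 - exp (-u)) - u * exp (-u))) u := by
      have he : HasDerivAt (fun u : ℝ => exp (-u)) (-exp (-u)) u := by
        simpa using (hasDerivAt_neg u).exp
      have h := ((((hasDerivAt_id u).add ((he.sub_const 1).const_mul 2)).sub
        (((he.pow 2).sub_const 1).div_const 2)).const_mul 3).sub
        ((hasDerivAt_id u).mul ((he.const_sub 1).pow 2))
      refine h.congr_deriv ?_
      simp only [id, Nat.cast_ofNat, Pi.pow_apply]
      ring
    refine monotoneOn_of_deriv_nonneg (convex_Ici 0)
      (fun u _ => (hd u).continuousAt.continuousWithinAt)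
      (fun u _ => (hd u).differentiableAt.differentiableWithinAt) fun u hu => ?_
    rw [interior_Ici, Set.mem_Ioi] at hu
    rw [(hd u).deriv]
    have h1 : exp (-u) ≤ 1 := exp_le_one_iff.2 (by linarith)
    have h2 : exp u * exp (-u) = 1 := by rw [← exp_add]; simp
    have h3 : (u + 1) * exp (-u) ≤ 1 :=
      (mul_le_mul_of_nonneg_right (add_one_le_exp u) (exp_pos _).le).trans_eq h2
    exact mul_nonneg (by linarith) (by linarith)
  have h := hmono (Set.mem_Ici.2 le_rfl) (Set.mem_Ici.2 hx) hx
  have h2 : exp (-(2 * x)) = exp (-x) ^ 2 := by rw [← exp_nat_mul]; congr 1; push_cast; ring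
  simp only [neg_zero, exp_zero] at h
  rw [h2]
  linarith

/-- Absorbing half a power of `A` into an exponential weight. -/
lemma exp_mul_sq_le_rpow {A x t : ℝ} (hA : 0 ≤ A) (hx : 0 < x) (h : A ^ 2 * x ≤ 3 * t) :
    exp (-t / 3) * A ^ 2 ≤ 2 * x ^ (-(1 : ℝ) / 4) * A ^ ((3 : ℝ) / 2) := by
  set a := A ^ ((1 : ℝ) / 2) with ha
  set q := x ^ ((1 : ℝ) / 4) with hq
  have ha0 : 0 ≤ a := rpow_nonneg hA _
  have hq0 : 0 < q := rpow_pos_of_pos hx _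
  have ha4 : a ^ 4 = A ^ 2 := by
    rw [ha, ← rpow_natCast, ← rpow_mul hA, ← rpow_natCast]; norm_num
  have ha3 : A ^ ((3 : ℝ) / 2) = a ^ 3 := by
    rw [ha, ← rpow_natCast, ← rpow_mul hA]; norm_num
  have hq4 : q ^ 4 = x := by
    rw [hq, ← rpow_natCast, ← rpow_mul hx.le]; norm_num
  have hqi : x ^ (-(1 : ℝ) / 4) = q⁻¹ := by
    rw [hq, ← rpow_neg hx.le]; norm_num
  have key : exp (-t / 3) * a * q ≤ 2 := by
    refine le_of_pow_le_pow_left₀ (n := 4) (by norm_num) (by norm_num) ?_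
    have he : exp (-t / 3) ^ 4 = (exp (4 * t / 3))⁻¹ := by
      rw [← exp_nat_mul, ← exp_neg]; congr 1; push_cast; ring
    rw [mul_pow, mul_pow, ha4, hq4, he, mul_assoc, inv_mul_le_iff₀ (exp_pos _)]
    have := add_one_le_exp (4 * t / 3)
    have : 0 ≤ A ^ 2 * x := by positivity
    linarith
  rw [← ha4, ha3, hqi, mul_right_comm, ← div_eq_mul_inv, le_div_iff₀ hq0]
  calc exp (-t / 3) * a ^ 4 * q = exp (-t / 3) * a * q * a ^ 3 := by ring
    _ ≤ 2 * a ^ 3 := by gcongr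

/-- hypoelliptic smoothing estimate
`S(s,k)^{1/3} |k|² ((1-e^{-νs})/ν)² ≤ C (νs)^{-1/4} |k|^{3/2} ((1-e^{-νs})/ν)^{3/2}`. -/
theorem stmt12 :
    ∃ C : ℝ, 0 < C ∧
      ∀ (n : ℕ), 1 ≤ n → ∀ ν : ℝ, 0 < ν → ∀ k : Fin n → ℤ, k ≠ 0 → ∀ s : ℝ, 0 < s →
        (Sker ν s k) ^ ((1 : ℝ) / 3) * ((knorm k) ^ 2 * ((1 - Real.exp (-(ν * s))) / ν) ^ 2)
          ≤ C * (ν * s) ^ (-(1 : ℝ) / 4) * (knorm k) ^ ((3 : ℝ) / 2)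
              * ((1 - Real.exp (-(ν * s))) / ν) ^ ((3 : ℝ) / 2) := by
  refine ⟨2, by norm_num, fun n _ ν hν k _ s hs => ?_⟩
  have hκ : 0 ≤ knorm k := sqrt_nonneg _
  have hx : 0 < ν * s := mul_pos hν hs
  have hz : 0 ≤ (1 - exp (-(ν * s))) / ν :=
    div_nonneg (sub_nonneg.2 (exp_le_one_iff.2 (by linarith))) hν.le
  rw [mul_assoc _ (knorm k ^ _), ← mul_rpow hκ hz, ← mul_pow]
  have hS : Sker ν s k ^ ((1 : ℝ) / 3) = exp (-((knorm k / ν) ^ 2 * (ν * s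
      + 2 * (exp (-(ν * s)) - 1) - (exp (-(2 * (ν * s))) - 1) / 2)) / 3) := by
    rw [Sker, ← exp_mul, mul_assoc 2 ν s]
    congr 1
    field_simp
  rw [hS]
  refine exp_mul_sq_le_rpow (mul_nonneg hκ hz) hx ?_
  calc (knorm k * ((1 - exp (-(ν * s))) / ν)) ^ 2 * (ν * s)
      = (knorm k / ν) ^ 2 * (ν * s * (1 - exp (-(ν * s))) ^ 2) := by ring
    _ ≤ (knorm k / ν) ^ 2 * (3 * (ν * s + 2 * (exp (-(ν * s)) - 1)
          - (exp (-(2 * (ν * s))) - 1) / 2)) :=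
        mul_le_mul_of_nonneg_left (mul_one_sub_exp_neg_sq_le hx.le) (sq_nonneg _)
    _ = _ := by ring
end
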